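/- Let 0 < k < N and let κ = ⌈2^{N−1}/(2^k − 1)⌉. There exist subsets Y_1, …, Y_κ of {0,1}^N with Y_1 ∪ ⋯ ∪ Y_κ = {0,1}^N such that, for each i, every probability distribution on {0,1}^N with support contained in Y_i lies in the closure of the k-interaction exponential family E^k; that is, {0,1}^N can be covered by κ S-sets of E^k. -/

import Mathlib

/-- A probability distribution on a finite set `X`. -/
def IsDist {X : Type*} [Fintype X] (p : X → ℝ) : Prop :=
  (∀ x, 0 ≤ p x) ∧ ∑ x, p x = 1

/-- `g` depends only on the coordinates in `s`. -/
def DependsOnlyOn {N : ℕ} {X : Fin N → Type*} (s : Finset (Fin N))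
    (g : ((i : Fin N) → X i) → ℝ) : Prop :=
  ∀ x y, (∀ i ∈ s, x i = y i) → g x = g y

/-- The `k`-interaction exponential family on `X = X_1 × ⋯ × X_N`. -/
def interactionFamily (k : ℕ) {N : ℕ} {X : Fin N → Type*} [∀ i, Fintype (X i)] :
    Set (((i : Fin N) → X i) → ℝ) :=
  {p | ∃ F : Finset (Fin N) → ((i : Fin N) → X i) → ℝ,
    (∀ s, DependsOnlyOn s (F s)) ∧ (∀ s, k < s.card → F s = 0) ∧
    ∀ x, p x = Real.exp (∑ s, F s x) / ∑ y, Real.exp (∑ s, F s y)}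

/-- The space of functions on `{0,1}^n` spanned by functions of at most `k` coordinates. -/
def interactionSpace (n k : ℕ) : Submodule ℝ ((Fin n → Fin 2) → ℝ) :=
  Submodule.span ℝ {g | ∃ s : Finset (Fin n), s.card ≤ k ∧ DependsOnlyOn s g}

lemma mem_interactionSpace_of_dependsOnlyOn {n k : ℕ} {s : Finset (Fin n)} (hs : s.card ≤ k)
    {g : (Fin n → Fin 2) → ℝ} (hg : DependsOnlyOn s g) : g ∈ interactionSpace n k :=
  Submodule.subset_span ⟨s, hs, hg⟩

lemma const_mem_interactionSpace (n k : ℕ) (c : ℝ) :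
    (fun _ ↦ c) ∈ interactionSpace n k :=
  mem_interactionSpace_of_dependsOnlyOn (s := ∅) (by simp) fun _ _ _ ↦ rfl

lemma mem_interactionSpace_zero_left (k : ℕ) (g : (Fin 0 → Fin 2) → ℝ) :
    g ∈ interactionSpace 0 k :=
  mem_interactionSpace_of_dependsOnlyOn (s := ∅) (by simp) fun _ _ _ ↦
    congrArg g (Subsingleton.elim _ _)

lemma interactionSpace_mono (n : ℕ) {k l : ℕ} (h : k ≤ l) :
    interactionSpace n k ≤ interactionSpace n l :=
  Submodule.span_mono fun _ ⟨s, hs, hg⟩ ↦ ⟨s, hs.trans h, hg⟩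

lemma comp_tail_mem_interactionSpace {n k : ℕ} {g : (Fin n → Fin 2) → ℝ}
    (hg : g ∈ interactionSpace n k) :
    (fun x : Fin (n + 1) → Fin 2 ↦ g (Fin.tail x)) ∈ interactionSpace (n + 1) k := by
  refine (Submodule.span_le (p := (interactionSpace (n + 1) k).comap
    (LinearMap.funLeft ℝ ℝ (fun x : Fin (n + 1) → Fin 2 ↦ Fin.tail x)))).2 ?_ hg
  rintro g ⟨s, hs, hg⟩
  refine mem_interactionSpace_of_dependsOnlyOn (s := s.map (Fin.succEmb n)) (by simpa) ?_
  exact fun x y h ↦ hg _ _ fun i hi ↦ h i.succ (Finset.mem_map_of_mem _ hi)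

lemma ite_comp_tail_mem_interactionSpace {n k : ℕ} {g : (Fin n → Fin 2) → ℝ}
    (hg : g ∈ interactionSpace n k) (b : Fin 2) :
    (fun x : Fin (n + 1) → Fin 2 ↦ if x 0 = b then g (Fin.tail x) else 0) ∈
      interactionSpace (n + 1) (k + 1) := by
  let L : ((Fin n → Fin 2) → ℝ) →ₗ[ℝ] ((Fin (n + 1) → Fin 2) → ℝ) :=
    { toFun := fun g x ↦ if x 0 = b then g (Fin.tail x) else 0
      map_add' := fun f g ↦ by ext x; by_cases h : x 0 = b <;> simp [h]
      map_smul' := fun c g ↦ by ext x; simp }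
  refine (Submodule.span_le (p := (interactionSpace (n + 1) (k + 1)).comap L)).2 ?_ hg
  rintro g ⟨s, hs, hg⟩
  refine mem_interactionSpace_of_dependsOnlyOn (s := insert 0 (s.map (Fin.succEmb n)))
    ((Finset.card_insert_le _ _).trans (by simpa)) fun x y h ↦ ?_
  have h0 : x 0 = y 0 := h 0 (Finset.mem_insert_self _ _)
  have ht : g (Fin.tail x) = g (Fin.tail y) := hg _ _ fun i hi ↦
    h i.succ (Finset.mem_insert_of_mem (Finset.mem_map_of_mem _ hi))
  simp [L, h0, ht]

lemma exists_sum_eq_of_mem_interactionSpace {n k : ℕ} {g : (Fin n → Fin 2) → ℝ}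
    (hg : g ∈ interactionSpace n k) :
    ∃ F : Finset (Fin n) → (Fin n → Fin 2) → ℝ,
      (∀ s, DependsOnlyOn s (F s)) ∧ (∀ s, k < s.card → F s = 0) ∧ ∀ x, g x = ∑ s, F s x := by
  induction hg using Submodule.span_induction with
  | mem g h =>
    obtain ⟨s, hs, hg⟩ := h
    refine ⟨Pi.single s g, fun t ↦ ?_, fun t ht ↦ ?_, fun x ↦ ?_⟩
    · by_cases h : t = s
      · subst h; simpa using hg
      · simp [Pi.single_eq_of_ne h, DependsOnlyOn]
    · have hts : t ≠ s := by rintro rfl; omega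
      exact Pi.single_eq_of_ne (M := fun _ ↦ (Fin n → Fin 2) → ℝ) hts g
    · rw [← Finset.sum_apply, Finset.sum_pi_single']
      simp
  | zero => exact ⟨0, fun _ _ _ _ ↦ rfl, fun _ _ ↦ rfl, by simp⟩
  | add f g _ _ hf hg =>
    obtain ⟨F, hF, hF0, hFs⟩ := hf
    obtain ⟨G, hG, hG0, hGs⟩ := hg
    refine ⟨F + G, fun s x y h ↦ ?_, fun s hs ↦ ?_, fun x ↦ ?_⟩
    · simp [hF s x y h, hG s x y h]
    · simp [hF0 s hs, hG0 s hs]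
    · simp [hFs, hGs, Finset.sum_add_distrib]
  | smul c f _ hf =>
    obtain ⟨F, hF, hF0, hFs⟩ := hf
    refine ⟨c • F, fun s x y h ↦ ?_, fun s hs ↦ ?_, fun x ↦ ?_⟩
    · simp [hF s x y h]
    · simp [hF0 s hs]
    · simp [hFs, Finset.mul_sum]

/-- The slice `{w | (b, w) ∈ Z}`. -/
def firstSlice {n : ℕ} (Z : Finset (Fin (n + 1) → Fin 2)) (b : Fin 2) : Finset (Fin n → Fin 2) :=
  {w | (Fin.cons b w : Fin (n + 1) → Fin 2) ∈ Z}

lemma mem_firstSlice {n : ℕ} {Z : Finset (Fin (n + 1) → Fin 2)} {b : Fin 2} {w : Fin n → Fin 2} :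
    w ∈ firstSlice Z b ↔ (Fin.cons b w : Fin (n + 1) → Fin 2) ∈ Z := by
  simp [firstSlice]

lemma tail_mem_firstSlice {n : ℕ} {Z : Finset (Fin (n + 1) → Fin 2)} {x : Fin (n + 1) → Fin 2}
    {b : Fin 2} (h : x 0 = b) : Fin.tail x ∈ firstSlice Z b ↔ x ∈ Z := by
  rw [mem_firstSlice, ← h, Fin.cons_self_tail]

lemma card_firstSlice_add {n : ℕ} (Z : Finset (Fin (n + 1) → Fin 2)) :
    (firstSlice Z 0).card + (firstSlice Z 1).card = Z.card := by
  have key (b : Fin 2) : (firstSlice Z b).card = (Z.filter fun x ↦ x 0 = b).card := by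
    refine Finset.card_bij (fun w _ ↦ Fin.cons b w) (fun w hw ↦ ?_)
      (fun v _ w _ h ↦ Fin.cons_right_injective _ h) fun x hx ↦ ?_
    · simpa using mem_firstSlice.1 hw
    · obtain ⟨hxZ, rfl⟩ := Finset.mem_filter.1 hx
      exact ⟨Fin.tail x, (tail_mem_firstSlice rfl).2 hxZ, Fin.cons_self_tail x⟩
  rw [key, key, ← Finset.card_filter_add_card_filter_not (s := Z) (fun x ↦ x 0 = 0)]
  congr 2
  ext x
  have : ∀ b : Fin 2, b = 1 ↔ ¬ b = 0 := by decide
  simp [this]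

lemma exists_card_firstSlice_lt {n k : ℕ} {Z : Finset (Fin (n + 1) → Fin 2)}
    (hZ : Z.card < 2 ^ (k + 1)) :
    ∃ b c : Fin 2, (∀ d, d ≠ b → d = c) ∧ (firstSlice Z b).card < 2 ^ k ∧
      (firstSlice Z c).card < 2 ^ (k + 1) := by
  have h := card_firstSlice_add Z
  rw [pow_succ] at *
  by_cases h0 : (firstSlice Z 0).card < 2 ^ k
  · exact ⟨0, 1, by decide, h0, by omega⟩
  · exact ⟨1, 0, by decide, by omega, by omega⟩

/-- Functions on fewer than `2^(k+1)` points are restrictions of functions of degree at most `k`. -/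
lemma exists_mem_interactionSpace_eqOn (n k : ℕ) (Z : Finset (Fin n → Fin 2))
    (hZ : Z.card < 2 ^ (k + 1)) (h : (Fin n → Fin 2) → ℝ) :
    ∃ g ∈ interactionSpace n k, ∀ z ∈ Z, g z = h z := by
  induction n generalizing k with
  | zero => exact ⟨h, mem_interactionSpace_zero_left k h, fun _ _ ↦ rfl⟩
  | succ n ih =>
    cases k with
    | zero =>
      rcases Z.eq_empty_or_nonempty with rfl | ⟨z₀, hz₀⟩
      · exact ⟨0, zero_mem _, by simp⟩
      · refine ⟨fun _ ↦ h z₀, const_mem_interactionSpace _ _ _, fun z hz ↦ ?_⟩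
        rw [Finset.card_le_one.1 (by omega) z hz z₀ hz₀]
    | succ k =>
      obtain ⟨b, c, hbc, hb, hc⟩ := exists_card_firstSlice_lt hZ
      obtain ⟨f, hf, hfZ⟩ := ih (k + 1) _ hc fun w ↦ h (Fin.cons c w)
      obtain ⟨g, hg, hgZ⟩ := ih k _ hb fun w ↦ h (Fin.cons b w) - f w
      refine ⟨_, add_mem (comp_tail_mem_interactionSpace hf)
        (ite_comp_tail_mem_interactionSpace hg b), fun x hx ↦ ?_⟩
      by_cases hxb : x 0 = b
      · have := hgZ _ ((tail_mem_firstSlice hxb).2 hx)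
        rw [← hxb, Fin.cons_self_tail] at this
        simp [hxb, this]
      · have hxc := hbc _ hxb
        have := hfZ _ ((tail_mem_firstSlice hxc).2 hx)
        rw [← hxc, Fin.cons_self_tail] at this
        simp [hxb, this]

lemma exists_forall_pos_add_mul {α : Type*} [Finite α] (s : Set α) (u r : α → ℝ)
    (hr : ∀ x ∈ s, 0 < r x) : ∃ M : ℝ, ∀ x ∈ s, 0 < u x + M * r x := by
  obtain ⟨M, hM⟩ := (Set.finite_range fun x ↦ (1 - u x) / r x).bddAbove
  refine ⟨M, fun x hx ↦ ?_⟩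
  have := (div_le_iff₀ (hr x hx)).1 (hM ⟨x, rfl⟩)
  linarith

/-- Every set of fewer than `2^k` points is the zero set of a nonnegative function of degree at
most `k`. -/
lemma exists_mem_interactionSpace_zero_pos (n k : ℕ) (Z : Finset (Fin n → Fin 2))
    (hZ : Z.card < 2 ^ k) :
    ∃ f ∈ interactionSpace n k, (∀ z ∈ Z, f z = 0) ∧ ∀ z ∉ Z, 0 < f z := by
  induction n generalizing k with
  | zero =>
    exact ⟨fun z ↦ if z ∈ Z then 0 else 1, mem_interactionSpace_zero_left k _,
      fun z hz ↦ by simp [hz], fun z hz ↦ by simp [hz]⟩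
  | succ n ih =>
    cases k with
    | zero =>
      obtain rfl : Z = ∅ := by simpa using hZ
      exact ⟨fun _ ↦ 1, const_mem_interactionSpace _ _ _, by simp, by simp⟩
    | succ k =>
      obtain ⟨b, c, hbc, hb, hc⟩ := exists_card_firstSlice_lt hZ
      obtain ⟨f, hf, hf0, hfpos⟩ := ih (k + 1) _ hc
      obtain ⟨r, hr, hr0, hrpos⟩ := ih k _ hb
      obtain ⟨g, hg, hgZ⟩ := exists_mem_interactionSpace_eqOn n k _
        (hb.trans (Nat.pow_lt_pow_succ one_lt_two)) fun w ↦ -f w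
      obtain ⟨M, hM⟩ := exists_forall_pos_add_mul {w | w ∉ firstSlice Z b} (f + g) r hrpos
      refine ⟨_, add_mem (comp_tail_mem_interactionSpace hf) (ite_comp_tail_mem_interactionSpace
        (add_mem hg (Submodule.smul_mem _ M hr)) b), fun x hx ↦ ?_, fun x hx ↦ ?_⟩
      · by_cases hxb : x 0 = b
        · have hx' := (tail_mem_firstSlice hxb).2 hx
          simp [hxb, hgZ _ hx', hr0 _ hx']
        · simp [hxb, hf0 _ ((tail_mem_firstSlice (hbc _ hxb)).2 hx)]
      · by_cases hxb : x 0 = b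
        · have := hM _ (mt (tail_mem_firstSlice hxb).1 hx)
          simpa [hxb, add_assoc] using this
        · simpa [hxb] using hfpos _ (mt (tail_mem_firstSlice (hbc _ hxb)).1 hx)

lemma exp_div_mem_interactionFamily {n k : ℕ} {g : (Fin n → Fin 2) → ℝ}
    (hg : g ∈ interactionSpace n k) :
    (fun x ↦ Real.exp (g x) / ∑ y, Real.exp (g y)) ∈
      interactionFamily k (X := fun _ : Fin n ↦ Fin 2) := by
  obtain ⟨F, hF, hF0, hFs⟩ := exists_sum_eq_of_mem_interactionSpace hg
  exact ⟨F, hF, hF0, fun x ↦ by simp [hFs]⟩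

/-- A set on which every function is interpolated by one of degree at most `k`, and which is the
zero set of a nonnegative function of degree at most `k`, is an S-set. -/
lemma mem_closure_interactionFamily {n k : ℕ} {Y : Set (Fin n → Fin 2)}
    (hY : ∀ h : (Fin n → Fin 2) → ℝ, ∃ g ∈ interactionSpace n k, ∀ y ∈ Y, g y = h y)
    {f : (Fin n → Fin 2) → ℝ} (hf : f ∈ interactionSpace n k)
    (hf0 : ∀ y ∈ Y, f y = 0) (hfpos : ∀ y ∉ Y, 0 < f y)
    {p : (Fin n → Fin 2) → ℝ} (hp : IsDist p) (hpY : {x | 0 < p x} ⊆ Y) :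
    p ∈ closure (interactionFamily k (X := fun _ : Fin n ↦ Fin 2)) := by
  have key (ε : ℝ) (hε : 0 < ε) : ∃ g ∈ interactionSpace n k,
      ∀ x, |Real.exp (g x) - p x| ≤ ε := by
    obtain ⟨g, hg, hgY⟩ := hY fun x ↦ Real.log (p x + ε)
    obtain ⟨M, hM⟩ := exists_forall_pos_add_mul Yᶜ (fun x ↦ Real.log ε - g x) f hfpos
    refine ⟨g - M • f, sub_mem hg (Submodule.smul_mem _ M hf), fun x ↦ ?_⟩
    by_cases hx : x ∈ Y
    · simp [hgY x hx, hf0 x hx, Real.exp_log (add_pos_of_nonneg_of_pos (hp.1 x) hε),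
        abs_of_pos hε]
    · have hpx : p x = 0 := le_antisymm (not_lt.1 fun h ↦ hx (hpY h)) (hp.1 x)
      have h := hM x hx
      have : Real.exp (g x - M * f x) ≤ ε := by
        rw [← Real.le_log_iff_exp_le hε]
        linarith
      simpa [hpx] using this
  choose! g hg hgp using key
  have hlim : Filter.Tendsto (fun m : ℕ ↦ fun x ↦ Real.exp (g (1 / ((m : ℝ) + 1)) x))
      Filter.atTop (nhds p) := by
    refine tendsto_pi_nhds.2 fun x ↦ tendsto_iff_dist_tendsto_zero.2 ?_
    refine squeeze_zero (fun _ ↦ dist_nonneg) (fun m ↦ ?_)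
      tendsto_one_div_add_atTop_nhds_zero_nat
    exact hgp _ (by positivity) x
  have hsum := tendsto_finsetSum Finset.univ fun x _ ↦ tendsto_pi_nhds.1 hlim x
  rw [hp.2] at hsum
  refine mem_closure_of_tendsto (b := Filter.atTop) (f := fun m : ℕ ↦ fun x ↦
    Real.exp (g (1 / ((m : ℝ) + 1)) x) / ∑ y, Real.exp (g (1 / ((m : ℝ) + 1)) y)) ?_
    (Filter.Eventually.of_forall fun m ↦ exp_div_mem_interactionFamily (hg _ (by positivity)))
  refine tendsto_pi_nhds.2 fun x ↦ ?_
  have h := (tendsto_pi_nhds.1 hlim x).div hsum one_ne_zero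
  rwa [div_one] at h

/-- The union of fewer than `2^(k+1)` parallel edges of the cube is an S-set of the
`(k+1)`-interaction family. -/
lemma mem_closure_interactionFamily_of_tail_mem {n k : ℕ} {Z : Finset (Fin n → Fin 2)}
    (hZ : Z.card < 2 ^ (k + 1)) {p : (Fin (n + 1) → Fin 2) → ℝ} (hp : IsDist p)
    (hpZ : {x | 0 < p x} ⊆ {x | Fin.tail x ∈ Z}) :
    p ∈ closure (interactionFamily (k + 1) (X := fun _ : Fin (n + 1) ↦ Fin 2)) := by
  obtain ⟨f, hf, hf0, hfpos⟩ := exists_mem_interactionSpace_zero_pos n (k + 1) Z hZ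
  refine mem_closure_interactionFamily (fun h ↦ ?_) (comp_tail_mem_interactionSpace hf)
    (fun x hx ↦ hf0 _ hx) (fun x hx ↦ hfpos _ hx) hp hpZ
  choose g hg hgZ using fun b : Fin 2 ↦
    exists_mem_interactionSpace_eqOn n k Z hZ fun w ↦ h (Fin.cons b w)
  refine ⟨_, sum_mem fun b (_ : b ∈ Finset.univ) ↦
    ite_comp_tail_mem_interactionSpace (hg b) b, fun x hx ↦ ?_⟩
  simp [Finset.sum_apply, hgZ (x 0) _ hx]

/-- A finite type of cardinality `c` is covered by `⌈c/m⌉` finsets of cardinality at most `m`. -/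
lemma exists_cover_card_le (α : Type*) [Fintype α] {m : ℕ} (hm : 0 < m) :
    ∃ Z : Fin ((Fintype.card α + m - 1) / m) → Finset α,
      (∀ a, ∃ i, a ∈ Z i) ∧ ∀ i, (Z i).card ≤ m := by
  classical
  let e := Fintype.equivFin α
  refine ⟨fun i ↦ {a | (e a : ℕ) / m = i}, fun a ↦ ?_, fun i ↦ ?_⟩
  · refine ⟨⟨(e a : ℕ) / m, ?_⟩, by simp⟩
    have ha := (e a).isLt
    rw [Nat.lt_iff_add_one_le, ← Nat.add_div_right _ hm]
    exact Nat.div_le_div_right (by omega)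
  · have hsub : ∀ a ∈ ({a | (e a : ℕ) / m = i} : Finset α),
        (e a : ℕ) ∈ Finset.Ico (i * m : ℕ) (i * m + m) := fun a ha ↦ by
      have h := (Nat.div_eq_iff hm).1 (Finset.mem_filter.1 ha).2
      rw [Finset.mem_Ico]
      omega
    simpa using Finset.card_le_card_of_injOn (fun a ↦ (e a : ℕ)) hsub
      fun a _ b _ h ↦ e.injective (Fin.ext h)

/-- `{0,1}^N` can be covered by `κ = ⌈2^(N-1)/(2^k - 1)⌉` S-sets
of the `k`-interaction exponential family. -/
theorem stmt_6 (N k : ℕ) (hk : 0 < k) (hkN : k < N) :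
    ∃ Y : Fin ((2 ^ (N - 1) + (2 ^ k - 1) - 1) / (2 ^ k - 1)) →
        Set (Fin N → Fin 2),
      (⋃ i, Y i) = Set.univ ∧
      ∀ i, ∀ p : (Fin N → Fin 2) → ℝ, IsDist p → {x | 0 < p x} ⊆ Y i →
        p ∈ closure (interactionFamily k) := by
  obtain ⟨n, rfl⟩ : ∃ n, N = n + 1 := ⟨N - 1, by omega⟩
  obtain ⟨j, rfl⟩ : ∃ j, k = j + 1 := ⟨k - 1, by omega⟩
  have hm : 1 < 2 ^ (j + 1) := Nat.one_lt_two_pow (by omega)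
  have hcard : Fintype.card (Fin n → Fin 2) = 2 ^ (n + 1 - 1) := by simp
  obtain ⟨Z, hcov, hZ⟩ := exists_cover_card_le (Fin n → Fin 2) (Nat.sub_pos_of_lt hm)
  rw [← hcard]
  refine ⟨fun i ↦ {x | Fin.tail x ∈ Z i}, ?_, fun i p hp hpZ ↦ ?_⟩
  · exact Set.eq_univ_of_forall fun x ↦ Set.mem_iUnion.2 (hcov (Fin.tail x))
  · refine mem_closure_interactionFamily_of_tail_mem (Z := Z i) ?_ hp hpZ
    have := hZ i
    omega
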